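/- arXiv:1905.10280 — 2 statements merged into one kernel-verified Lean document; each statement's English description precedes it below -/
import Mathlib

section
/- For all real θ > 0 and y > 0, Im[ψ₂(θ)·ψ₂(iy) − ψ₃(θ)·ψ₁(iy)] > 0, i.e. Im[4·S₃(θ)·S₃(iy) − 6·S₄(θ)·S₂(iy)] > 0. (Since ψ₂(θ) < 0, this says Im h'(iy) < 0 for y > 0, where h'(z) = (λ²/2)[(ψ₂(θ) − (ψ₃(θ)/ψ₂(θ))ψ₁(θ)) − (ψ₂(z) − (ψ₃(θ)/ψ₂(θ))ψ₁(z))]; i.e. the imaginary axis is a barrier for the level lines of Re h.) -/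
open Complex

/-- `S j z = ∑_{k=0}^∞ 1/(z+k)^j`, the series defining the polygamma functions:
`ψ₁ = S₂`, `ψ₂ = −2S₃`, `ψ₃ = 6S₄`. -/
noncomputable def S (j : ℕ) (z : ℂ) : ℂ := ∑' k : ℕ, 1 / (z + k) ^ j

theorem summable_one_div_add_int_pow (z : ℂ) {j : ℕ} (hj : 2 ≤ j) :
    Summable fun n : ℤ => 1 / (z + n) ^ j := by
  refine (EisensteinSeries.linear_right_summable z 1 (k := (j : ℤ)) (by exact_mod_cast hj)).congr
    fun n => ?_
  simp

theorem summable_one_div_add_nat_pow (z : ℂ) {j : ℕ} (hj : 2 ≤ j) :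
    Summable fun n : ℕ => 1 / (z + n) ^ j := by
  simpa [Function.comp_def] using
    (summable_one_div_add_int_pow z hj).comp_injective Nat.cast_injective

theorem S_ofReal (j : ℕ) (x : ℝ) :
    S j (x : ℂ) = ((∑' k : ℕ, 1 / (x + k) ^ j : ℝ) : ℂ) := by
  rw [S, Complex.ofReal_tsum]
  push_cast
  rfl

theorem tsum_one_div_add_nat_pow_pos {x : ℝ} (hx : 0 < x) {j : ℕ} (hj : 2 ≤ j) :
    0 < ∑' k : ℕ, 1 / (x + k) ^ j := by
  have hs : Summable fun k : ℕ => 1 / (x + k) ^ j := by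
    rw [← Complex.summable_ofReal]
    exact (summable_one_div_add_nat_pow (x : ℂ) hj).congr fun k => by push_cast; rfl
  exact hs.tsum_pos (fun k => by positivity) 0 (by positivity)

theorem one_div_mul_I_add_sq_im (y t : ℝ) :
    (1 / ((y : ℂ) * I + t) ^ 2).im = -(2 * y * t) / (y ^ 2 + t ^ 2) ^ 2 := by
  rw [one_div, Complex.inv_im, map_pow]
  congr 1
  · simp [pow_two]
    ring
  · simp [Complex.normSq_apply]
    ring

theorem S_two_mul_I_im_neg {y : ℝ} (hy : 0 < y) : (S 2 ((y : ℂ) * I)).im < 0 := by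
  have hs := summable_one_div_add_nat_pow ((y : ℂ) * I) le_rfl
  have him (k : ℕ) : (1 / ((y : ℂ) * I + k) ^ 2).im = -(2 * y * k) / (y ^ 2 + k ^ 2) ^ 2 := by
    simpa using one_div_mul_I_add_sq_im y k
  rw [S, Complex.im_tsum hs, ← neg_pos, ← tsum_neg]
  refine (Complex.imCLM.summable hs).neg.tsum_pos (fun k => ?_) 1 ?_
  · simp only [Complex.imCLM_apply, him, neg_div, neg_neg]
    positivity
  · simp only [Complex.imCLM_apply, him, neg_div, neg_neg]
    positivity

theorem one_div_mul_I_sub_cube_im (y t : ℝ) :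
    (1 / ((y : ℂ) * I - t) ^ 3).im = (1 / ((y : ℂ) * I + t) ^ 3).im := by
  have h : ((y : ℂ) * I - t) ^ 3 = -(starRingEnd ℂ) (((y : ℂ) * I + t) ^ 3) := by
    simp only [map_pow, map_add, map_mul, Complex.conj_ofReal, Complex.conj_I]
    ring
  rw [h, div_neg, Complex.neg_im, ← map_one (starRingEnd ℂ), ← map_div₀, Complex.conj_im, neg_neg]
  simp

theorem tsum_int_one_div_mul_I_add_cube_im_nonneg {y : ℝ} (hy : 0 < y) :
    0 ≤ (∑' n : ℤ, 1 / ((y : ℂ) * I + n) ^ 3).im := by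
  have h := EisensteinSeries.qExpansion_identity (k := 2) one_le_two
    ⟨(y : ℂ) * I, by simpa using hy⟩
  have hc : (-2 * (Real.pi : ℂ) * I) ^ (2 + 1) / (Nat.factorial 2 : ℂ)
      = ((4 * Real.pi ^ 3 : ℝ) : ℂ) * I := by
    have hI : I ^ 3 = -I := Complex.I_pow_three
    simp only [Nat.reduceAdd, Nat.factorial_two]
    push_cast
    linear_combination (-4 * (Real.pi : ℂ) ^ 3) * hI
  have hq (n : ℕ) : (n : ℂ) ^ 2 * exp (2 * Real.pi * I * ((y : ℂ) * I)) ^ n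
      = (((n : ℝ) ^ 2 * Real.exp (-(2 * Real.pi * y)) ^ n : ℝ) : ℂ) := by
    have : 2 * (Real.pi : ℂ) * I * ((y : ℂ) * I) = ((-(2 * Real.pi * y) : ℝ) : ℂ) := by
      push_cast
      linear_combination (2 * Real.pi * y : ℂ) * Complex.I_mul_I
    rw [this]
    push_cast
    rfl
  simp only [hc, hq, Nat.reduceAdd, ← Complex.ofReal_tsum] at h
  rw [h, mul_right_comm, ← Complex.ofReal_mul, Complex.im_ofReal_mul, Complex.I_im, mul_one]
  positivity

theorem S_three_mul_I_im_pos {y : ℝ} (hy : 0 < y) : 0 < (S 3 ((y : ℂ) * I)).im := by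
  have hs := summable_one_div_add_nat_pow ((y : ℂ) * I) (j := 3) (by norm_num)
  have hneg : Summable fun n : ℕ => 1 / ((y : ℂ) * I + ((-n : ℤ) : ℂ)) ^ 3 :=
    (summable_one_div_add_int_pow ((y : ℂ) * I) (j := 3) (by norm_num)).comp_injective
      (i := fun n : ℕ => -(n : ℤ)) (neg_injective.comp Nat.cast_injective)
  have hsplit := Summable.tsum_of_nat_of_neg (f := fun n : ℤ => 1 / ((y : ℂ) * I + n) ^ 3)
    (by simpa using hs) hneg
  have hsymm : (∑' n : ℕ, 1 / ((y : ℂ) * I + ((-n : ℤ) : ℂ)) ^ 3).im = (S 3 ((y : ℂ) * I)).im := by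
    rw [S, Complex.im_tsum hneg, Complex.im_tsum hs]
    refine tsum_congr fun n => ?_
    simpa [sub_eq_add_neg] using one_div_mul_I_sub_cube_im y n
  have hzero : (1 / ((y : ℂ) * I + ((0 : ℤ) : ℂ)) ^ 3).im = 1 / y ^ 3 := by
    have hI : I ^ 3 = -I := Complex.I_pow_three
    have h : 1 / ((y : ℂ) * I + ((0 : ℤ) : ℂ)) ^ 3 = ((1 / y ^ 3 : ℝ) : ℂ) * I := by
      simp [mul_pow, hI, mul_comm]
    rw [h, Complex.im_ofReal_mul, Complex.I_im, mul_one]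
  have him := congrArg Complex.im hsplit
  rw [Complex.sub_im, Complex.add_im, hsymm, hzero] at him
  have hnat : (∑' n : ℕ, 1 / ((y : ℂ) * I + ((n : ℤ) : ℂ)) ^ 3) = S 3 ((y : ℂ) * I) := by
    simp [S]
  rw [hnat] at him
  have hint := tsum_int_one_div_mul_I_add_cube_im_nonneg hy
  have : 0 < 1 / y ^ 3 := by positivity
  linarith

/-- For all real `θ > 0` and `y > 0`,
`Im[ψ₂(θ)·ψ₂(iy) − ψ₃(θ)·ψ₁(iy)] = Im[4·S₃(θ)·S₃(iy) − 6·S₄(θ)·S₂(iy)] > 0`: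
the imaginary axis is a barrier for the level lines of `Re h`. -/
theorem imaginary_axis_barrier (θ y : ℝ) (hθ : 0 < θ) (hy : 0 < y) :
    0 < (4 * S 3 (θ : ℂ) * S 3 ((y : ℂ) * I)
          - 6 * S 4 (θ : ℂ) * S 2 ((y : ℂ) * I)).im := by
  have h3 := tsum_one_div_add_nat_pow_pos hθ (j := 3) (by norm_num)
  have h4 := tsum_one_div_add_nat_pow_pos hθ (j := 4) (by norm_num)
  have hA := mul_pos h3 (S_three_mul_I_im_pos hy)
  have hB := mul_neg_of_pos_of_neg h4 (S_two_mul_I_im_neg hy)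
  have h (a b : ℝ) (u v : ℂ) : (4 * (a : ℂ) * u - 6 * (b : ℂ) * v).im
      = 4 * (a * u.im) - 6 * (b * v.im) := by
    simp [mul_assoc]
  rw [S_ofReal, S_ofReal, h]
  linarith
end

section
/- For each index 1 ≤ i < k, the function u(t, x) defined by the k-fold contour integral below satisfies the boundary condition (∂_{x_i} ∂_{x_{i+1}} u + λ(∂_{x_i} u − ∂_{x_{i+1}} u))(t, x) = 0 for all t > 0 and all x ∈ ℝ^k with x_i = x_{i+1}. -/
open Complex MeasureTheory

/-- The contour-integral solution
`u(t,x) = (2π)^{−k} ∫_{ℝ^k} Π_{A<B} (w_B−w_A)/(w_B−w_A−w_A w_B)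
  · Π_j exp(tλ²w_j²/2 + λx_j w_j)/w_j ds`, where `w_j = α_j + i s_j`. -/
noncomputable def u (k : ℕ) (lam : ℝ) (α : Fin k → ℝ) (t : ℝ) (x : Fin k → ℝ) : ℂ :=
  (((2 * Real.pi) ^ k : ℝ))⁻¹ *
    ∫ s : Fin k → ℝ,
      (∏ p ∈ Finset.univ.filter (fun p : Fin k × Fin k => p.1 < p.2),
        ((((α p.2 : ℂ) + (s p.2 : ℂ) * Complex.I) - ((α p.1 : ℂ) + (s p.1 : ℂ) * Complex.I)) /
          ((((α p.2 : ℂ) + (s p.2 : ℂ) * Complex.I) - ((α p.1 : ℂ) + (s p.1 : ℂ) * Complex.I))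
            - ((α p.1 : ℂ) + (s p.1 : ℂ) * Complex.I) * ((α p.2 : ℂ) + (s p.2 : ℂ) * Complex.I)))) *
      ∏ j : Fin k,
        Complex.exp ((t : ℂ) * (lam : ℂ) ^ 2 * ((α j : ℂ) + (s j : ℂ) * Complex.I) ^ 2 / 2
            + (lam : ℂ) * (x j : ℂ) * ((α j : ℂ) + (s j : ℂ) * Complex.I)) /
          ((α j : ℂ) + (s j : ℂ) * Complex.I)

section VerticalPoint

variable {ι : Type*}

/-- The point of `∏ j, (α j + i ℝ)` with imaginary parts `s`. -/
def verticalPoint (α s : ι → ℝ) : ι → ℂ := fun j => (α j : ℂ) + (s j : ℂ) * I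

@[simp] lemma verticalPoint_re (α s : ι → ℝ) (j : ι) : (verticalPoint α s j).re = α j := by
  simp [verticalPoint]

@[simp] lemma verticalPoint_im (α s : ι → ℝ) (j : ι) : (verticalPoint α s j).im = s j := by
  simp [verticalPoint]

lemma continuous_verticalPoint (α : ι → ℝ) : Continuous (verticalPoint α) := by
  unfold verticalPoint
  fun_prop

end VerticalPoint

section Moderate

variable {ι : Type*} [Fintype ι] {S : Set (ι → ℂ)} {R Q : (ι → ℂ) → ℂ}

/-- `R` is holomorphic at each point of `S` and grows at most exponentially on `S`. -/
structure ModerateOn (S : Set (ι → ℂ)) (R : (ι → ℂ) → ℂ) : Prop where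
  differentiableAt : ∀ w ∈ S, DifferentiableAt ℂ R w
  growth : ∃ C m : ℝ, 0 ≤ C ∧ 0 ≤ m ∧ ∀ w ∈ S, ‖R w‖ ≤ C * Real.exp (m * ∑ j, ‖w j‖)

namespace ModerateOn

lemma const (a : ℂ) : ModerateOn S fun _ => a :=
  ⟨fun _ _ => by fun_prop, ‖a‖, 0, norm_nonneg _, le_rfl, fun w _ => by simp⟩

lemma coord (p : ι) : ModerateOn S fun w => w p := by
  refine ⟨fun _ _ => by fun_prop, 1, 1, zero_le_one, zero_le_one, fun w _ => ?_⟩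
  have h := Finset.single_le_sum (f := fun j => ‖w j‖) (fun j _ => norm_nonneg _)
    (Finset.mem_univ p)
  have := Real.add_one_le_exp (∑ j, ‖w j‖)
  simp only [one_mul]
  linarith

lemma mul (hR : ModerateOn S R) (hQ : ModerateOn S Q) : ModerateOn S fun w => R w * Q w := by
  obtain ⟨C, m, hC, hm, h⟩ := hR.growth
  obtain ⟨C', m', hC', hm', h'⟩ := hQ.growth
  refine ⟨fun w hw => (hR.differentiableAt w hw).mul (hQ.differentiableAt w hw),
    C * C', m + m', by positivity, by positivity, fun w hw => ?_⟩
  rw [norm_mul, add_mul, Real.exp_add, mul_mul_mul_comm]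
  exact mul_le_mul (h w hw) (h' w hw) (norm_nonneg _) (by positivity)

lemma sub (hR : ModerateOn S R) (hQ : ModerateOn S Q) : ModerateOn S fun w => R w - Q w := by
  obtain ⟨C, m, hC, hm, h⟩ := hR.growth
  obtain ⟨C', m', hC', hm', h'⟩ := hQ.growth
  refine ⟨fun w hw => (hR.differentiableAt w hw).sub (hQ.differentiableAt w hw),
    C + C', m + m', by positivity, by positivity, fun w hw => ?_⟩
  have hs : 0 ≤ ∑ j, ‖w j‖ := Finset.sum_nonneg fun j _ => norm_nonneg _
  calc ‖R w - Q w‖ ≤ ‖R w‖ + ‖Q w‖ := norm_sub_le _ _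
    _ ≤ C * Real.exp (m * ∑ j, ‖w j‖) + C' * Real.exp (m' * ∑ j, ‖w j‖) :=
        add_le_add (h w hw) (h' w hw)
    _ ≤ C * Real.exp ((m + m') * ∑ j, ‖w j‖) + C' * Real.exp ((m + m') * ∑ j, ‖w j‖) := by
        gcongr <;> linarith
    _ = _ := by ring

lemma inv (hR : ModerateOn S R) {δ : ℝ} (hδ : 0 < δ) (h : ∀ w ∈ S, δ ≤ ‖R w‖) :
    ModerateOn S fun w => (R w)⁻¹ := by
  refine ⟨fun w hw => (hR.differentiableAt w hw).inv (norm_pos_iff.1 (hδ.trans_le (h w hw))),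
    δ⁻¹, 0, by positivity, le_rfl, fun w hw => ?_⟩
  simpa using inv_anti₀ hδ (h w hw)

lemma prod {κ : Type*} (P : Finset κ) {f : κ → (ι → ℂ) → ℂ}
    (h : ∀ p ∈ P, ModerateOn S (f p)) : ModerateOn S fun w => ∏ p ∈ P, f p w := by
  classical
  induction P using Finset.induction_on with
  | empty => simpa using const 1
  | insert a P ha ih =>
    simp only [Finset.prod_insert ha]
    exact (h a (Finset.mem_insert_self _ _)).mul
      (ih fun p hp => h p (Finset.mem_insert_of_mem hp))

end ModerateOn

/-- The Gaussian weight `exp (∑ j, (c w_j² + lam x_j w_j))`. -/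
noncomputable def gaussWeight (c lam : ℝ) (x : ι → ℝ) (w : ι → ℂ) : ℂ :=
  Complex.exp (∑ j, ((c : ℂ) * w j ^ 2 + (lam : ℂ) * (x j : ℂ) * w j))

lemma differentiable_gaussWeight (c lam : ℝ) (x : ι → ℝ) :
    Differentiable ℂ (gaussWeight c lam x) := by
  unfold gaussWeight
  fun_prop

lemma norm_gaussWeight (c lam : ℝ) (x : ι → ℝ) (w : ι → ℂ) :
    ‖gaussWeight c lam x w‖ =
      Real.exp (∑ j, (c * ((w j).re ^ 2 - (w j).im ^ 2) + lam * x j * (w j).re)) := by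
  rw [gaussWeight, Complex.norm_exp, Complex.re_sum]
  congr 1
  refine Finset.sum_congr rfl fun j _ => ?_
  simp [pow_two]

lemma ModerateOn.exists_norm_mul_gaussWeight_le (hR : ModerateOn S R) {c : ℝ} (hc : 0 < c)
    (lam A M : ℝ) : ∃ C, 0 ≤ C ∧ ∀ w ∈ S, (∀ j, |(w j).re| ≤ A) →
      ∀ x : ι → ℝ, (∀ j, |x j| ≤ M) →
      ‖R w * gaussWeight c lam x w‖ ≤ C * Real.exp (-(c / 2) * ∑ j, (w j).im ^ 2) := by
  obtain ⟨C, m, hC, hm, h⟩ := hR.growth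
  let K : ℝ := m * A + m ^ 2 / (2 * c) + c * A ^ 2 + |lam| * M * A
  refine ⟨C * Real.exp (∑ _j : ι, K), by positivity, fun w hw hA x hx => ?_⟩
  rw [norm_mul, norm_gaussWeight]
  calc _ ≤ C * Real.exp (m * ∑ j, ‖w j‖) *
        Real.exp (∑ j, (c * ((w j).re ^ 2 - (w j).im ^ 2) + lam * x j * (w j).re)) := by
        gcongr
        exact h w hw
    _ ≤ _ := by
      rw [mul_assoc, mul_assoc, ← Real.exp_add, ← Real.exp_add, Finset.mul_sum, Finset.mul_sum,
        ← Finset.sum_add_distrib, ← Finset.sum_add_distrib]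
      refine mul_le_mul_of_nonneg_left (Real.exp_le_exp.2 (Finset.sum_le_sum fun j _ => ?_)) hC
      have h1 : ‖w j‖ ≤ A + |(w j).im| :=
        (Complex.norm_le_abs_re_add_abs_im _).trans (by linarith [hA j])
      have h2 : m * ‖w j‖ ≤ m * A + m * |(w j).im| := by nlinarith
      have h3 : (w j).re ^ 2 ≤ A ^ 2 := sq_le_sq' (by linarith [abs_le.1 (hA j)]) (abs_le.1 (hA j)).2
      have h4 : lam * x j * (w j).re ≤ |lam| * M * A := by
        refine (le_abs_self _).trans ?_
        rw [abs_mul, abs_mul]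
        have := (abs_nonneg (x j)).trans (hx j)
        gcongr
        exacts [hx j, hA j]
      have h5 : m * |(w j).im| ≤ c / 2 * (w j).im ^ 2 + m ^ 2 / (2 * c) := by
        have h6 : c / 2 * (w j).im ^ 2 + m ^ 2 / (2 * c) - m * |(w j).im| =
            (c * |(w j).im| - m) ^ 2 / (2 * c) := by
          rw [← sq_abs (w j).im]
          field_simp
          ring
        have : 0 ≤ (c * |(w j).im| - m) ^ 2 / (2 * c) := by positivity
        linarith
      have h7 := mul_le_mul_of_nonneg_left h3 hc.le
      simp only [K]
      linarith

lemma integrable_exp_neg_mul_sum_sq {b : ℝ} (hb : 0 < b) :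
    Integrable fun s : ι → ℝ => Real.exp (-b * ∑ j, s j ^ 2) := by
  simp_rw [Finset.mul_sum, Real.exp_sum]
  exact Integrable.fintype_prod (fun _ => integrable_exp_neg_mul_sq hb)

lemma ModerateOn.continuous_comp_verticalPoint (hR : ModerateOn S R) {α : ι → ℝ}
    (hα : ∀ s, verticalPoint α s ∈ S) : Continuous fun s => R (verticalPoint α s) :=
  continuous_iff_continuousAt.2 fun s =>
    ((hR.differentiableAt _ (hα s)).continuousAt).comp
      (f := verticalPoint α) (continuous_verticalPoint α).continuousAt

lemma ModerateOn.continuous_mul_gaussWeight (hR : ModerateOn S R) {α : ι → ℝ}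
    (hα : ∀ s, verticalPoint α s ∈ S) (c lam : ℝ) (x : ι → ℝ) :
    Continuous fun s => R (verticalPoint α s) * gaussWeight c lam x (verticalPoint α s) :=
  (hR.continuous_comp_verticalPoint hα).mul
    ((differentiable_gaussWeight c lam x).continuous.comp (continuous_verticalPoint α))

lemma ModerateOn.exists_integrable_bound (hR : ModerateOn S R) {α : ι → ℝ}
    (hα : ∀ s, verticalPoint α s ∈ S) {c : ℝ} (hc : 0 < c) (lam M : ℝ) :
    ∃ g : (ι → ℝ) → ℝ, Integrable g ∧ ∀ x : ι → ℝ, (∀ j, |x j| ≤ M) → ∀ s,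
      ‖R (verticalPoint α s) * gaussWeight c lam x (verticalPoint α s)‖ ≤ g s := by
  obtain ⟨C, -, h⟩ := hR.exists_norm_mul_gaussWeight_le hc lam (∑ j, |α j|) M
  refine ⟨_, (integrable_exp_neg_mul_sum_sq (half_pos hc)).const_mul C, fun x hx s => ?_⟩
  simpa using h _ (hα s) (fun j => by
    simpa using Finset.single_le_sum (f := fun j => |α j|) (fun j _ => abs_nonneg _)
      (Finset.mem_univ j)) x hx

lemma ModerateOn.integrable (hR : ModerateOn S R) {α : ι → ℝ}
    (hα : ∀ s, verticalPoint α s ∈ S) {c : ℝ} (hc : 0 < c) (lam : ℝ) (x : ι → ℝ) :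
    Integrable fun s => R (verticalPoint α s) * gaussWeight c lam x (verticalPoint α s) := by
  obtain ⟨g, hg, h⟩ := hR.exists_integrable_bound hα hc lam (∑ j, |x j|)
  exact hg.mono' (hR.continuous_mul_gaussWeight hα c lam x).aestronglyMeasurable
    (.of_forall (h x fun j => Finset.single_le_sum (f := fun j => |x j|)
      (fun j _ => abs_nonneg _) (Finset.mem_univ j)))

/-- The integral of `R` against the Gaussian weight over `∏ j, (α j + i ℝ)`. -/
noncomputable def gaussIntegral (c lam : ℝ) (α : ι → ℝ) (R : (ι → ℂ) → ℂ) (x : ι → ℝ) : ℂ :=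
  ∫ s : ι → ℝ, R (verticalPoint α s) * gaussWeight c lam x (verticalPoint α s)

lemma hasDerivAt_gaussWeight [DecidableEq ι] (c lam : ℝ) (x : ι → ℝ) (p : ι) (w : ι → ℂ) (b : ℝ) :
    HasDerivAt (fun b : ℝ => gaussWeight c lam (Function.update x p b) w)
      ((lam : ℂ) * w p * gaussWeight c lam (Function.update x p b) w) b := by
  have key : HasDerivAt (fun b : ℝ => ∑ j, ((c : ℂ) * w j ^ 2 +
      (lam : ℂ) * (Function.update x p b j : ℂ) * w j)) ((lam : ℂ) * w p) b := by
    have h : ∀ j ∈ Finset.univ, HasDerivAt (fun b : ℝ => (c : ℂ) * w j ^ 2 +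
        (lam : ℂ) * (Function.update x p b j : ℂ) * w j)
        (if j = p then (lam : ℂ) * w j else 0) b := by
      intro j _
      by_cases hj : j = p
      · subst hj
        simpa using (((hasDerivAt_id b).ofReal_comp.const_mul (lam : ℂ)).mul_const
          (w j)).const_add ((c : ℂ) * w j ^ 2)
      · simpa [hj] using hasDerivAt_const b _
    simpa using HasDerivAt.fun_sum h
  simpa [gaussWeight, mul_comm] using key.cexp

lemma ModerateOn.hasDerivAt_gaussIntegral [DecidableEq ι] (hR : ModerateOn S R) {α : ι → ℝ}
    (hα : ∀ s, verticalPoint α s ∈ S) {c : ℝ} (hc : 0 < c) (lam : ℝ) (x : ι → ℝ) (p : ι) :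
    HasDerivAt (fun b => gaussIntegral c lam α R (Function.update x p b))
      (gaussIntegral c lam α (fun w => lam * w p * R w) x) (x p) := by
  have hR' : ModerateOn S fun w => lam * w p * R w := ((const _).mul (coord p)).mul hR
  obtain ⟨g, hg, h⟩ := hR'.exists_integrable_bound hα hc lam (∑ j, |x j| + 1)
  have key := (hasDerivAt_integral_of_dominated_loc_of_deriv_le (μ := volume)
    (F := fun b s => R (verticalPoint α s) *
      gaussWeight c lam (Function.update x p b) (verticalPoint α s))
    (F' := fun b s => lam * verticalPoint α s p * R (verticalPoint α s) *
      gaussWeight c lam (Function.update x p b) (verticalPoint α s))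
    (x₀ := x p) (bound := g) (Metric.ball_mem_nhds _ one_pos)
    (.of_forall fun b => (hR.continuous_mul_gaussWeight hα c lam _).aestronglyMeasurable)
    (hR.integrable hα hc lam _)
    (hR'.continuous_mul_gaussWeight hα c lam _).aestronglyMeasurable
    (.of_forall fun s b hb => ?_) hg (.of_forall fun s b _ => ?_)).2
  · simpa only [gaussIntegral, Function.update_eq_self] using key
  · refine h _ (fun j => ?_) s
    have h1 : ∀ j, |x j| ≤ ∑ j, |x j| := fun j =>
      Finset.single_le_sum (f := fun j => |x j|) (fun j _ => abs_nonneg _) (Finset.mem_univ j)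
    by_cases hj : j = p
    · subst hj
      have h2 : |b - x j| < 1 := by simpa [Real.dist_eq] using hb
      have h3 := abs_sub_abs_le_abs_sub b (x j)
      simp only [Function.update_self]
      linarith [h1 j]
    · simp only [Function.update_of_ne hj]
      linarith [h1 j]
  · exact ((hasDerivAt_gaussWeight c lam x p (verticalPoint α s) b).const_mul
      (R (verticalPoint α s))).congr_deriv (by ring)

end Moderate

/-- Moving the line of integration within a vertical strip. -/
lemma integral_vertical_line_eq {f : ℂ → ℂ} {a b : ℝ} (hab : a ≤ b)
    (hf : ∀ z : ℂ, z.re ∈ Set.Icc a b → DifferentiableAt ℂ f z) {g : ℝ → ℝ} (hg : Integrable g)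
    (hbound : ∀ z : ℂ, z.re ∈ Set.Icc a b → ‖f z‖ ≤ g z.im)
    (htop : Filter.Tendsto g Filter.atTop (nhds 0))
    (hbot : Filter.Tendsto g Filter.atBot (nhds 0)) :
    ∫ y : ℝ, f (a + y * I) = ∫ y : ℝ, f (b + y * I) := by
  have hint : ∀ σ ∈ Set.Icc a b, Integrable fun y : ℝ => f (σ + y * I) := by
    intro σ hσ
    refine hg.mono' (Continuous.aestronglyMeasurable ?_) (.of_forall fun y => ?_)
    · refine continuous_iff_continuousAt.2 fun y => ?_
      exact ContinuousAt.comp (f := fun y : ℝ => (σ : ℂ) + y * I)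
        (hf _ (by simpa using hσ)).continuousAt (by fun_prop)
    · simpa using hbound (σ + y * I) (by simpa using hσ)
  have hlim : ∀ σ ∈ Set.Icc a b, Filter.Tendsto (fun T : ℝ => ∫ y in (-T)..T, f (σ + y * I))
      Filter.atTop (nhds (∫ y : ℝ, f (σ + y * I))) := fun σ hσ =>
    intervalIntegral_tendsto_integral (hint σ hσ) Filter.tendsto_neg_atTop_atBot Filter.tendsto_id
  have hedge : ∀ T : ℝ, ‖∫ σ in a..b, f (σ + T * I)‖ ≤ g T * |b - a| := fun T =>
    intervalIntegral.norm_integral_le_of_norm_le_const fun σ hσ => by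
      rw [Set.uIoc_of_le hab] at hσ
      simpa using hbound (σ + T * I) (by simpa using ⟨hσ.1.le, hσ.2⟩)
  have htop' : Filter.Tendsto (fun T : ℝ => ∫ σ in a..b, f (σ + T * I)) Filter.atTop (nhds 0) :=
    squeeze_zero_norm hedge (by simpa using htop.mul_const |b - a|)
  have hbot' : Filter.Tendsto (fun T : ℝ => ∫ σ in a..b, f (σ + (-T : ℝ) * I)) Filter.atTop
      (nhds 0) :=
    squeeze_zero_norm (fun T => hedge (-T))
      (by simpa using (hbot.comp Filter.tendsto_neg_atTop_atBot).mul_const |b - a|)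
  have hrect : ∀ T : ℝ, (∫ σ in a..b, f (σ + (-T : ℝ) * I)) - (∫ σ in a..b, f (σ + T * I)) +
      I • (∫ y in (-T)..T, f (b + y * I)) - I • (∫ y in (-T)..T, f (a + y * I)) = 0 := by
    intro T
    have := Complex.integral_boundary_rect_eq_zero_of_differentiableOn f ⟨a, -T⟩ ⟨b, T⟩
      fun z hz => (hf z (by
        simpa [Set.uIcc_of_le hab] using (Complex.mem_reProdIm.1 hz).1)).differentiableWithinAt
    simpa using this
  have h0 := (((hbot'.sub htop').add ((hlim b ⟨hab, le_rfl⟩).const_smul I)).sub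
    ((hlim a ⟨le_rfl, hab⟩).const_smul I))
  simp only [hrect] at h0
  have h1 := tendsto_nhds_unique h0 tendsto_const_nhds
  rw [sub_zero, zero_add, ← smul_sub, smul_eq_mul, mul_eq_zero] at h1
  exact (sub_eq_zero.1 (h1.resolve_left I_ne_zero)).symm

lemma tendsto_exp_neg_mul_sq_cocompact {b : ℝ} (hb : 0 < b) :
    Filter.Tendsto (fun y : ℝ => Real.exp (-b * y ^ 2)) (Filter.cocompact ℝ) (nhds 0) := by
  simpa using tendsto_rpow_abs_mul_exp_neg_mul_sq_cocompact hb 0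

section ContourShift

variable {n : ℕ} {S : Set (Fin n → ℂ)} {R : (Fin n → ℂ) → ℂ}

lemma verticalPoint_update {ι : Type*} [DecidableEq ι] (α s : ι → ℝ) (p : ι) (σ y : ℝ) :
    verticalPoint (Function.update α p σ) (Function.update s p y) =
      Function.update (verticalPoint α s) p (σ + y * I) := by
  funext j
  by_cases hj : j = p
  · subst hj
    simp [verticalPoint]
  · simp [verticalPoint, hj]

lemma ModerateOn.integral_update_eq (hR : ModerateOn S R) {α : Fin n → ℝ} {p : Fin n} {b : ℝ}
    (hb : α p ≤ b)
    (hα : ∀ σ ∈ Set.Icc (α p) b, ∀ s, verticalPoint (Function.update α p σ) s ∈ S)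
    {c : ℝ} (hc : 0 < c) (lam : ℝ) (x s : Fin n → ℝ) :
    ∫ y : ℝ, R (verticalPoint α (Function.update s p y)) *
        gaussWeight c lam x (verticalPoint α (Function.update s p y)) =
      ∫ y : ℝ, R (verticalPoint (Function.update α p b) (Function.update s p y)) *
        gaussWeight c lam x (verticalPoint (Function.update α p b) (Function.update s p y)) := by
  obtain ⟨C, hC, h⟩ := hR.exists_norm_mul_gaussWeight_le hc lam (∑ j, |α j| + |b|) (∑ j, |x j|)
  have hsum : ∀ (v : Fin n → ℝ) j, |v j| ≤ ∑ j, |v j| := fun v j =>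
    Finset.single_le_sum (f := fun j => |v j|) (fun j _ => abs_nonneg _) (Finset.mem_univ j)
  have hpt : ∀ z : ℂ, Function.update (verticalPoint α s) p z =
      verticalPoint (Function.update α p z.re) (Function.update s p z.im) := fun z => by
    rw [verticalPoint_update, Complex.re_add_im]
  have hcoco := (tendsto_exp_neg_mul_sq_cocompact (half_pos hc)).const_mul C
  rw [mul_zero, cocompact_eq_atBot_atTop, Filter.tendsto_sup] at hcoco
  have key := integral_vertical_line_eq (f := fun z => R (Function.update (verticalPoint α s) p z) *
    gaussWeight c lam x (Function.update (verticalPoint α s) p z)) hb (fun z hz => ?_)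
    ((integrable_exp_neg_mul_sq (half_pos hc)).const_mul C) (fun z hz => ?_) hcoco.2 hcoco.1
  · have hself := fun y => verticalPoint_update α s p (α p) y
    rw [Function.update_eq_self] at hself
    simpa only [← hself, ← verticalPoint_update] using key
  · have hmem : Function.update (verticalPoint α s) p z ∈ S := hpt z ▸ hα _ hz _
    exact DifferentiableAt.comp (g := fun w => R w * gaussWeight c lam x w) z
      ((hR.differentiableAt _ hmem).mul (differentiable_gaussWeight c lam x _))
      (hasFDerivAt_update (𝕜 := ℂ) (verticalPoint α s) z).differentiableAt
  · rw [hpt]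
    refine (h _ (hα _ hz _) (fun j => ?_) x (hsum x)).trans ?_
    · rw [verticalPoint_re]
      by_cases hj : j = p
      · subst hj
        rw [Function.update_self]
        refine (abs_le_max_abs_abs hz.1 hz.2).trans (max_le ?_ ?_)
        · linarith [hsum α j, abs_nonneg b]
        · exact le_add_of_nonneg_left (Finset.sum_nonneg fun j _ => abs_nonneg _)
      · rw [Function.update_of_ne hj]
        linarith [hsum α j, abs_nonneg b]
    · have h1 := Finset.single_le_sum (f := fun j => Function.update s p z.im j ^ 2)
        (fun j _ => sq_nonneg _) (Finset.mem_univ p)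
      simp only [Function.update_self] at h1
      simp only [verticalPoint_im]
      exact mul_le_mul_of_nonneg_left (Real.exp_le_exp.2
        (mul_le_mul_of_nonpos_left h1 (by linarith))) hC

lemma integral_eq_integral_integral_update {n : ℕ} (p : Fin (n + 1)) {G : (Fin (n + 1) → ℝ) → ℂ}
    (hG : Integrable G) :
    ∫ s, G s = ∫ r : Fin n → ℝ, ∫ y : ℝ, G (Function.update (p.insertNth 0 r) p y) := by
  have hmp := (volume_preserving_piFinSuccAbove (fun _ : Fin (n + 1) => ℝ) p).symm
  have hme := (MeasurableEquiv.piFinSuccAbove (fun _ : Fin (n + 1) => ℝ) p).symm.measurableEmbedding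
  rw [← hmp.integral_comp hme, Measure.volume_eq_prod,
    integral_prod_symm (fun z => G ((MeasurableEquiv.piFinSuccAbove _ p).symm z))
      ((hmp.integrable_comp_emb hme).2 hG)]
  simp [MeasurableEquiv.piFinSuccAbove, Fin.insertNthEquiv]

lemma ModerateOn.gaussIntegral_update_eq (hR : ModerateOn S R) {α : Fin n → ℝ} {p : Fin n} {b : ℝ}
    (hb : α p ≤ b)
    (hα : ∀ σ ∈ Set.Icc (α p) b, ∀ s, verticalPoint (Function.update α p σ) s ∈ S)
    {c : ℝ} (hc : 0 < c) (lam : ℝ) (x : Fin n → ℝ) :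
    gaussIntegral c lam α R x = gaussIntegral c lam (Function.update α p b) R x := by
  obtain - | n := n
  · exact p.elim0
  have hself := hα (α p) ⟨le_rfl, hb⟩
  rw [Function.update_eq_self] at hself
  rw [gaussIntegral, gaussIntegral,
    integral_eq_integral_integral_update p (hR.integrable hself hc lam x),
    integral_eq_integral_integral_update p (hR.integrable (hα b ⟨hb, le_rfl⟩) hc lam x)]
  exact integral_congr_ae (.of_forall fun r => hR.integral_update_eq hb hα hc lam x _)

end ContourShift

lemma gaussIntegral_eq_zero_of_antisymm {ι : Type*} [Fintype ι] (τ : Equiv.Perm ι)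
    {R : (ι → ℂ) → ℂ} (hR : ∀ w, R (w ∘ τ) = -R w) {α x : ι → ℝ} (hα : α ∘ τ = α)
    (hx : x ∘ τ = x) (c lam : ℝ) : gaussIntegral c lam α R x = 0 := by
  have hpt : ∀ s, verticalPoint α (s ∘ τ) = verticalPoint α s ∘ τ := fun s => by
    funext j
    simp only [verticalPoint, Function.comp_apply]
    rw [← Function.comp_apply (f := α), hα]
  have hw : ∀ w, gaussWeight c lam x (w ∘ τ) = gaussWeight c lam x w := fun w => by
    rw [gaussWeight, gaussWeight]
    conv_rhs => rw [← Equiv.sum_comp τ]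
    congr 1
    refine Finset.sum_congr rfl fun j _ => ?_
    rw [← Function.comp_apply (f := x), hx, Function.comp_apply]
  let e := MeasurableEquiv.piCongrLeft (fun _ : ι => ℝ) τ.symm
  have he : ⇑e = fun s => s ∘ τ := by
    funext s j
    simp [e, MeasurableEquiv.coe_piCongrLeft, Equiv.piCongrLeft_apply]
  have hmp : MeasurePreserving e := volume_measurePreserving_piCongrLeft _ τ.symm
  have key : gaussIntegral c lam α R x = -gaussIntegral c lam α R x := by
    conv_lhs => rw [gaussIntegral, ← hmp.integral_comp e.measurableEmbedding]
    simp only [he, hpt, hR, hw, neg_mul, integral_neg, gaussIntegral]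
  exact self_eq_neg.1 key

section Kernel

variable {k : ℕ}

/-- The denominator `w_B - w_A - w_A w_B` attached to the pair `p = (A, B)`. -/
def pairDenom (p : Fin k × Fin k) (w : Fin k → ℂ) : ℂ := (w p.2 - w p.1) - w p.1 * w p.2

/-- The rational prefactor, with interaction factors for the pairs in `P`. -/
noncomputable def kernel (P : Finset (Fin k × Fin k)) (w : Fin k → ℂ) : ℂ :=
  (∏ p ∈ P, ((w p.2 - w p.1) * (pairDenom p w)⁻¹)) * ∏ j, (w j)⁻¹

/-- A set on which all the denominators in `kernel P` stay away from zero. -/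
def kernelDomain (P : Finset (Fin k × Fin k)) (δ : ℝ) : Set (Fin k → ℂ) :=
  {w | (∀ j, δ ≤ (w j).re) ∧
    ∀ p ∈ P, δ ≤ (w p.2).re - (w p.1).re - (w p.1).re * (w p.2).re}

lemma le_norm_sub_sub_mul {z w : ℂ} (hw : 0 < w.re) (h : 0 < w.re - z.re - z.re * w.re) :
    w.re - z.re - z.re * w.re ≤ ‖(w - z) - z * w‖ := by
  have hn : 1 + w.re ≤ ‖1 + w‖ := by simpa using Complex.re_le_norm (1 + w)
  have hsq : ‖1 + w‖ ^ 2 = (1 + w.re) ^ 2 + w.im ^ 2 := by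
    rw [← Complex.normSq_eq_norm_sq, Complex.normSq_apply]
    simp
    ring
  have hz : z.re < 1 := by nlinarith
  have hre : ‖1 + w‖ ^ 2 * (1 - z.re) - (1 + w.re) ≤ ‖(w - z) - z * w‖ * ‖1 + w‖ := by
    have := Complex.re_le_norm (((w - z) - z * w) * (starRingEnd ℂ) (1 + w))
    rw [norm_mul, Complex.norm_conj] at this
    refine le_trans (le_of_eq ?_) this
    rw [hsq]
    simp
    ring
  have hpos : 0 < ‖1 + w‖ := by linarith
  refine le_of_mul_le_mul_right (le_trans ?_ hre) hpos
  have : 0 ≤ (‖1 + w‖ - (1 + w.re)) * (‖1 + w‖ * (1 - z.re) + 1) :=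
    mul_nonneg (by linarith) (add_nonneg (mul_nonneg hpos.le (by linarith)) zero_le_one)
  nlinarith

lemma le_norm_pairDenom {P : Finset (Fin k × Fin k)} {δ : ℝ} (hδ : 0 < δ) {p : Fin k × Fin k}
    (hp : p ∈ P) {w : Fin k → ℂ} (hw : w ∈ kernelDomain P δ) : δ ≤ ‖pairDenom p w‖ :=
  (hw.2 p hp).trans (le_norm_sub_sub_mul (hδ.trans_le (hw.1 _)) (hδ.trans_le (hw.2 p hp)))

lemma moderateOn_kernel (P : Finset (Fin k × Fin k)) {δ : ℝ} (hδ : 0 < δ) :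
    ModerateOn (kernelDomain P δ) (kernel P) := by
  refine (ModerateOn.prod P fun p hp => ?_).mul (ModerateOn.prod Finset.univ fun j _ => ?_)
  · refine ((ModerateOn.coord _).sub (ModerateOn.coord _)).mul (ModerateOn.inv ?_ hδ
      fun w hw => le_norm_pairDenom hδ hp hw)
    exact ((ModerateOn.coord _).sub (ModerateOn.coord _)).sub
      ((ModerateOn.coord _).mul (ModerateOn.coord _))
  · exact (ModerateOn.coord j).inv hδ fun w hw => (hw.1 j).trans (Complex.re_le_norm _)

lemma kernelDomain_mono {P Q : Finset (Fin k × Fin k)} (h : Q ⊆ P) (δ : ℝ) :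
    kernelDomain P δ ⊆ kernelDomain Q δ :=
  fun _ hw => ⟨hw.1, fun p hp => hw.2 p (h hp)⟩

lemma exists_verticalPoint_mem_kernelDomain {P : Finset (Fin k × Fin k)} {α : Fin k → ℝ}
    (hpos : ∀ j, 0 < α j) (hP : ∀ p ∈ P, α p.1 < α p.2 / (1 + α p.2)) :
    ∃ δ₀ : ℝ, 0 < δ₀ ∧ ∀ δ ≤ δ₀, ∀ s, verticalPoint α s ∈ kernelDomain P δ := by
  have hev : ∀ {y : ℝ}, 0 < y → ∀ᶠ δ in nhdsWithin (0 : ℝ) (Set.Ioi 0), δ ≤ y := fun hy =>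
    nhdsWithin_le_nhds (Iic_mem_nhds hy)
  have h1 : ∀ᶠ δ in nhdsWithin (0 : ℝ) (Set.Ioi 0), ∀ j, δ ≤ α j :=
    Filter.eventually_all.2 fun j => hev (hpos j)
  have h2 : ∀ᶠ δ in nhdsWithin (0 : ℝ) (Set.Ioi 0),
      ∀ p ∈ P, δ ≤ α p.2 - α p.1 - α p.1 * α p.2 :=
    (Filter.eventually_all_finset P).2 fun p hp => hev (by
      have := (lt_div_iff₀ (by linarith [hpos p.2])).1 (hP p hp)
      linarith)
  obtain ⟨δ, ⟨h1, h2⟩, h0⟩ := ((h1.and h2).and self_mem_nhdsWithin).exists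
  refine ⟨δ, h0, fun δ' hδ' s => ⟨fun j => ?_, fun p hp => ?_⟩⟩
  · simpa using hδ'.trans (h1 j)
  · simpa using hδ'.trans (h2 p hp)

lemma verticalPoint_update_mem_kernelDomain {P : Finset (Fin k × Fin k)}
    (hP : ∀ p ∈ P, p.1 ≠ p.2) {δ : ℝ} {α : Fin k → ℝ} {q : Fin k} {a b σ : ℝ}
    (hσ : σ ∈ Set.Icc a b) (s : Fin k → ℝ)
    (ha : verticalPoint (Function.update α q a) s ∈ kernelDomain P δ)
    (hb : verticalPoint (Function.update α q b) s ∈ kernelDomain P δ) :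
    verticalPoint (Function.update α q σ) s ∈ kernelDomain P δ := by
  obtain ⟨t, r, ht, hr, htr, rfl⟩ : σ ∈ segment ℝ a b :=
    (segment_eq_Icc (hσ.1.trans hσ.2)) ▸ hσ
  have hconv : ∀ {u v : ℝ}, δ ≤ u → δ ≤ v → δ ≤ t * u + r * v := fun {u v} hu hv => by
    have : δ = t * δ + r * δ := by rw [← add_mul, htr, one_mul]
    rw [this]
    gcongr
  obtain rfl : r = 1 - t := by linarith
  refine ⟨fun j => ?_, fun p hp => ?_⟩
  · refine (hconv (ha.1 j) (hb.1 j)).trans_eq ?_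
    by_cases hj : j = q
    · simp [hj]
    · simp [hj]
      ring
  · refine (hconv (ha.2 p hp) (hb.2 p hp)).trans_eq ?_
    have hne := hP p hp
    by_cases h1 : p.1 = q
    · have h2 : p.2 ≠ q := fun h => hne (h1.trans h.symm)
      simp [h1, h2]
      ring
    · by_cases h2 : p.2 = q
      · simp [h1, h2]
        ring
      · simp [h1, h2]
        ring

lemma kernel_comp_perm (τ : Equiv.Perm (Fin k)) {P : Finset (Fin k × Fin k)}
    (hP : ∀ p, p ∈ P ↔ (τ p.1, τ p.2) ∈ P) (w : Fin k → ℂ) :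
    kernel P (w ∘ τ) = kernel P w := by
  unfold kernel
  congr 1
  · exact Finset.prod_equiv (Equiv.prodCongr τ τ) (fun p => hP p) fun p _ => rfl
  · exact Equiv.prod_comp τ fun j => (w j)⁻¹

lemma u_eq_gaussIntegral (k : ℕ) (lam : ℝ) (α : Fin k → ℝ) (t : ℝ) (x : Fin k → ℝ) :
    u k lam α t x = ((((2 * Real.pi) ^ k)⁻¹ : ℝ) : ℂ) * gaussIntegral (t * lam ^ 2 / 2) lam α
      (kernel (Finset.univ.filter fun p : Fin k × Fin k => p.1 < p.2)) x := by
  unfold u gaussIntegral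
  congr 2
  funext s
  simp only [kernel, pairDenom, gaussWeight, verticalPoint, Complex.exp_sum, div_eq_mul_inv,
    Finset.prod_mul_distrib]
  have hcomm : ∀ a b d : ℂ, a * (b * d) = a * d * b := fun _ _ _ => by ring
  refine (hcomm _ _ _).trans ?_
  congr 1
  refine Finset.prod_congr rfl fun j _ => ?_
  congr 1
  push_cast
  ring

end Kernel

/-- For each `1 ≤ i < k`, the function `u(t,x)` satisfies the boundary condition
`(∂_{x_i}∂_{x_{i+1}} u + λ(∂_{x_i} u − ∂_{x_{i+1}} u))(t,x) = 0` whenever `x_i = x_{i+1}`. -/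
theorem u_boundary_condition (k : ℕ) (hk : 1 ≤ k) (lam : ℝ) (hlam : 0 < lam)
    (α : Fin k → ℝ) (hpos : ∀ i, 0 < α i)
    (hord : ∀ i j : Fin k, i < j → α i < α j / (1 + α j))
    (i : ℕ) (hi : i + 1 < k) (t : ℝ) (ht : 0 < t) (x : Fin k → ℝ)
    (hx : x ⟨i, Nat.lt_of_succ_lt hi⟩ = x ⟨i + 1, hi⟩) :
    deriv (fun a : ℝ => deriv (fun b : ℝ =>
        u k lam α t (Function.update (Function.update x ⟨i, Nat.lt_of_succ_lt hi⟩ a) ⟨i + 1, hi⟩ b))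
        (x ⟨i + 1, hi⟩)) (x ⟨i, Nat.lt_of_succ_lt hi⟩)
      + (lam : ℂ) *
        (deriv (fun a : ℝ => u k lam α t (Function.update x ⟨i, Nat.lt_of_succ_lt hi⟩ a))
            (x ⟨i, Nat.lt_of_succ_lt hi⟩)
          - deriv (fun b : ℝ => u k lam α t (Function.update x ⟨i + 1, hi⟩ b))
              (x ⟨i + 1, hi⟩)) = 0 := by
  set p : Fin k := ⟨i, Nat.lt_of_succ_lt hi⟩ with hp
  set q : Fin k := ⟨i + 1, hi⟩ with hq
  have hpq : p < q := by simp [hp, hq, Fin.lt_def]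
  set P := Finset.univ.filter fun p : Fin k × Fin k => p.1 < p.2 with hPdef
  have hPmem : ∀ r, r ∈ P ↔ r.1 < r.2 := by simp [hPdef]
  have hc : 0 < t * lam ^ 2 / 2 := by positivity
  set c := t * lam ^ 2 / 2
  have hlt : α p < α q := (hord p q hpq).trans_le
    (div_le_self (hpos q).le (by linarith [hpos q]))
  obtain ⟨δ, hδ, hα⟩ := exists_verticalPoint_mem_kernelDomain hpos
    (P := P) fun r hr => hord _ _ ((hPmem r).1 hr)
  have hα := hα δ le_rfl
  have hK := moderateOn_kernel P hδ
  have hcoord : ∀ r, ModerateOn (kernelDomain P δ) fun w => (lam : ℂ) * w r := fun r =>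
    (ModerateOn.const _).mul (ModerateOn.coord r)
  -- the derivatives, as Gaussian integrals
  have hderiv : ∀ {R : (Fin k → ℂ) → ℂ}, ModerateOn (kernelDomain P δ) R → ∀ (a : ℂ) y r,
      deriv (fun b => a * gaussIntegral c lam α R (Function.update y r b)) (y r) =
        a * gaussIntegral c lam α (fun w => lam * w r * R w) y := fun hR a y r =>
    ((hR.hasDerivAt_gaussIntegral hα hc lam y r).const_mul a).deriv
  have hinner : ∀ a : ℝ, deriv (fun b : ℝ => u k lam α t
      (Function.update (Function.update x p a) q b)) (x q) =
      ((((2 * Real.pi) ^ k)⁻¹ : ℝ) : ℂ) *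
        gaussIntegral c lam α (fun w => lam * w q * kernel P w) (Function.update x p a) := fun a => by
    have h := hderiv hK ((((2 * Real.pi) ^ k)⁻¹ : ℝ) : ℂ) (Function.update x p a) q
    rw [Function.update_of_ne hpq.ne'] at h
    simp only [u_eq_gaussIntegral]
    exact h
  simp only [hinner]
  simp only [u_eq_gaussIntegral]
  rw [hderiv ((hcoord q).mul hK), hderiv hK, hderiv hK]
  -- the combination of the three integrands cancels the factor of the pair `(p, q)`
  let Q := fun w : Fin k → ℂ => (w q - w p) * kernel (P.erase (p, q)) w
  have hcombine : gaussIntegral c lam α (fun w => lam * w p * (lam * w q * kernel P w)) x +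
      lam * (gaussIntegral c lam α (fun w => lam * w p * kernel P w) x -
        gaussIntegral c lam α (fun w => lam * w q * kernel P w) x) =
      -lam ^ 2 * gaussIntegral c lam α Q x := by
    simp only [gaussIntegral]
    have hp_int := ((hcoord p).mul hK).integrable hα hc lam x
    have hq_int := ((hcoord q).mul hK).integrable hα hc lam x
    have hpq_int := ((hcoord p).mul ((hcoord q).mul hK)).integrable hα hc lam x
    have hsub_int : Integrable fun s : Fin k → ℝ => (lam : ℂ) * (_ - _) :=
      (hp_int.sub hq_int).const_mul _
    rw [← integral_sub hp_int hq_int, ← integral_const_mul, ← integral_const_mul,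
      ← integral_add hpq_int hsub_int]
    congr 1
    funext s
    set w := verticalPoint α s
    have hne : pairDenom (p, q) w ≠ 0 := norm_pos_iff.1
      (hδ.trans_le (le_norm_pairDenom hδ ((hPmem _).2 hpq) (hα s)))
    have hker : kernel P w * pairDenom (p, q) w = Q w := by
      simp only [Q, kernel]
      rw [← Finset.mul_prod_erase P _ ((hPmem (p, q)).2 hpq)]
      field_simp
    rw [← hker, pairDenom]
    ring
  have hzero : gaussIntegral c lam α Q x = 0 := by
    have hPne : ∀ r ∈ P.erase (p, q), r.1 ≠ r.2 := fun r hr =>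
      ((hPmem r).1 (Finset.mem_of_mem_erase hr)).ne
    obtain ⟨δ', hδ', hα'⟩ := exists_verticalPoint_mem_kernelDomain (P := P.erase (p, q))
      (α := Function.update α p (α q)) (fun j => by
        by_cases hj : j = p
        · simpa [hj] using hpos q
        · simpa [hj] using hpos j) fun r hr => by
      obtain ⟨hr1, hr2⟩ := Finset.mem_erase.1 hr
      rw [hPmem] at hr2
      by_cases h1 : r.1 = p
      · have h2 : r.2 ≠ p := fun h => hr2.ne (h1.trans h.symm)
        have h3 : r.2 ≠ q := fun h => hr1 (Prod.ext h1 h)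
        rw [h1, Function.update_self, Function.update_of_ne h2]
        refine hord _ _ ?_
        rw [Fin.lt_def]
        rw [Fin.lt_def, h1] at hr2
        rw [Ne, Fin.ext_iff] at h3
        simp only [hp, hq] at *
        omega
      · rw [Function.update_of_ne h1]
        by_cases h2 : r.2 = p
        · rw [h2, Function.update_self]
          exact hord _ _ ((h2 ▸ hr2).trans hpq)
        · rw [Function.update_of_ne h2]
          exact hord _ _ hr2
    have hmin : 0 < min δ δ' := lt_min hδ hδ'
    have hQ : ModerateOn (kernelDomain (P.erase (p, q)) (min δ δ')) Q :=
      ((ModerateOn.coord q).sub (ModerateOn.coord p)).mul (moderateOn_kernel _ hmin)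
    rw [hQ.gaussIntegral_update_eq hlt.le (fun σ hσ s =>
      verticalPoint_update_mem_kernelDomain hPne hσ s ?_ (hα' _ (min_le_right _ _) s)) hc]
    · refine gaussIntegral_eq_zero_of_antisymm (Equiv.swap p q) (fun w => ?_) ?_ ?_ c lam
      · have hsymm := kernel_comp_perm (Equiv.swap p q) (P := P.erase (p, q)) (fun r => ?_) w
        · simp only [Q, hsymm, Function.comp_apply, Equiv.swap_apply_left,
            Equiv.swap_apply_right]
          ring
        · obtain ⟨⟨a, ha⟩, ⟨b, hb⟩⟩ := r
          simp only [Finset.mem_erase, hPmem, Equiv.swap_apply_def, hp, hq, ne_eq, Prod.mk.injEq,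
            Fin.mk.injEq, Fin.lt_def]
          split_ifs <;> simp <;> omega
      · funext j
        simp only [Function.comp_apply, Equiv.swap_apply_def]
        split_ifs with h1 h2
        · simp [h1, hpq.ne']
        · simp [h2, hpq.ne']
        · rfl
      · funext j
        simp only [Function.comp_apply, Equiv.swap_apply_def]
        split_ifs with h1 h2
        · rw [h1, hx]
        · rw [h2, hx]
        · rfl
    · rw [Function.update_eq_self]
      have h := kernelDomain_mono (Finset.erase_subset (p, q) P) δ (hα s)
      exact ⟨fun j => (min_le_left _ _).trans (h.1 j),
        fun r hr => (min_le_left _ _).trans (h.2 r hr)⟩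
  rw [hzero, mul_zero] at hcombine
  linear_combination ((((2 * Real.pi) ^ k)⁻¹ : ℝ) : ℂ) * hcombine
end
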